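/- Let G = (V,E) be a finite simple graph and let C ⊆ V be a clique, with I = V \ C. Let (V1', V2') be any cut of G; set I1 = V1' ∩ I, I2 = V2' ∩ I, and m = |V1' ∩ C|. Then there exists a subset C1 ⊆ C with |C1| = m, consisting of m vertices v of C with the largest values of |N(v) ∩ I2| − |N(v) ∩ I1|, such that the cut (C1 ∪ I1, (C \ C1) ∪ I2) has size at least that of (V1', V2'), i.e. |E(C1 ∪ I1, (C \ C1) ∪ I2)| ≥ |E(V1', V2')|. -/

import Mathlib

open Finset

/-- The size of the cut `(A, B)`: the number of edges with one endpoint in `A`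
and the other in `B` (for disjoint `A`, `B`). -/
def cutSize {V : Type*} [Fintype V] [DecidableEq V] (G : SimpleGraph V) [DecidableRel G.Adj]
    (A B : Finset V) : ℕ :=
  ((A ×ˢ B).filter fun p => G.Adj p.1 p.2).card

theorem cutSize_eq_sum {V : Type*} [Fintype V] [DecidableEq V] (G : SimpleGraph V)
    [DecidableRel G.Adj] (A B : Finset V) :
    (cutSize G A B : ℤ) = ∑ a ∈ A, ∑ b ∈ B, if G.Adj a b then (1 : ℤ) else 0 := by
  unfold cutSize
  rw [Finset.card_filter, Finset.sum_product]
  push_cast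
  rfl

theorem nbr_card_eq_sum {V : Type*} [Fintype V] [DecidableEq V] (G : SimpleGraph V)
    [DecidableRel G.Adj] (v : V) (B : Finset V) :
    ((G.neighborFinset v ∩ B).card : ℤ) = ∑ b ∈ B, if G.Adj v b then (1 : ℤ) else 0 := by
  have h : G.neighborFinset v ∩ B = B.filter (fun b => G.Adj v b) := by
    ext b; simp [and_comm]
  rw [h, Finset.card_filter]
  push_cast
  rfl

theorem cutSize_formula {V : Type*} [Fintype V] [DecidableEq V] (G : SimpleGraph V)
    [DecidableRel G.Adj] (C : Finset V) (hC : ∀ u ∈ C, ∀ v ∈ C, u ≠ v → G.Adj u v)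
    (I1 I2 : Finset V) (h1 : Disjoint C I1) (h2 : Disjoint C I2) (D : Finset V) (hD : D ⊆ C) :
    (cutSize G (D ∪ I1) ((C \ D) ∪ I2) : ℤ) =
      (D.card : ℤ) * (C.card - D.card) + cutSize G I1 I2
      + ∑ v ∈ C, ((G.neighborFinset v ∩ I1).card : ℤ)
      + ∑ v ∈ D, (((G.neighborFinset v ∩ I2).card : ℤ) - (G.neighborFinset v ∩ I1).card) := by
  have hd1 : Disjoint D I1 := Finset.disjoint_of_subset_left hD h1
  have hd2 : Disjoint (C \ D) I2 := Finset.disjoint_of_subset_left Finset.sdiff_subset h2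
  have e1 : ∑ a ∈ D, ∑ b ∈ C \ D, (if G.Adj a b then (1 : ℤ) else 0)
      = (D.card : ℤ) * (C.card - D.card) := by
    have : ∀ a ∈ D, ∑ b ∈ C \ D, (if G.Adj a b then (1 : ℤ) else 0) = (C.card - D.card : ℤ) := by
      intro a ha
      have h : ∀ b ∈ C \ D, (if G.Adj a b then (1 : ℤ) else 0) = 1 := by
        intro b hb
        rw [Finset.mem_sdiff] at hb
        rw [if_pos]
        exact hC a (hD ha) b hb.1 (fun h => hb.2 (h ▸ ha))
      rw [Finset.sum_congr rfl h, Finset.sum_const, Finset.card_sdiff_of_subset hD, nsmul_eq_mul,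
        Nat.cast_sub (Finset.card_le_card hD), mul_one]
    rw [Finset.sum_congr rfl this, Finset.sum_const, nsmul_eq_mul]
  have e2 : ∑ a ∈ I1, ∑ b ∈ C \ D, (if G.Adj a b then (1 : ℤ) else 0)
      = ∑ v ∈ C \ D, ((G.neighborFinset v ∩ I1).card : ℤ) := by
    rw [Finset.sum_comm]
    refine Finset.sum_congr rfl fun v _ => ?_
    rw [nbr_card_eq_sum]
    simp only [G.adj_comm]
  have e3 := Finset.sum_sdiff (f := fun v => ((G.neighborFinset v ∩ I1).card : ℤ)) hD
  rw [cutSize_eq_sum, Finset.sum_union hd1]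
  simp only [Finset.sum_union hd2, Finset.sum_add_distrib]
  rw [e1, e2, cutSize_eq_sum, Finset.sum_sub_distrib]
  simp only [← nbr_card_eq_sum] at e3 ⊢
  linarith

theorem stmt_6 {V : Type*} [Fintype V] [DecidableEq V] (G : SimpleGraph V) [DecidableRel G.Adj]
    (C : Finset V) (hC : ∀ u ∈ C, ∀ v ∈ C, u ≠ v → G.Adj u v)
    (I : Finset V) (hI : I = Finset.univ \ C)
    (V1' V2' : Finset V) (hcut : V1' ∪ V2' = Finset.univ) (hdisj : Disjoint V1' V2')
    (I1 I2 : Finset V) (hI1 : I1 = V1' ∩ I) (hI2 : I2 = V2' ∩ I)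
    (m : ℕ) (hm : m = (V1' ∩ C).card) :
    ∃ C1 ⊆ C, C1.card = m ∧
      -- `C1` consists of `m` vertices of `C` with the largest values of
      -- `|N(v) ∩ I2| - |N(v) ∩ I1|`
      (∀ u ∈ C1, ∀ w ∈ C \ C1,
        ((G.neighborFinset w ∩ I2).card : ℤ) - (G.neighborFinset w ∩ I1).card ≤
          ((G.neighborFinset u ∩ I2).card : ℤ) - (G.neighborFinset u ∩ I1).card) ∧
      cutSize G V1' V2' ≤ cutSize G (C1 ∪ I1) ((C \ C1) ∪ I2) := by
  have h1 : Disjoint C I1 := by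
    rw [Finset.disjoint_left]; subst hI1 hI; intro a ha; simp [ha]
  have h2 : Disjoint C I2 := by
    rw [Finset.disjoint_left]; subst hI2 hI; intro a ha; simp [ha]
  have hmem : V1' ∩ C ∈ Finset.powersetCard m C :=
    Finset.mem_powersetCard.2 ⟨Finset.inter_subset_right, hm.symm⟩
  obtain ⟨C1, hC1, hmax⟩ := Finset.exists_max_image (Finset.powersetCard m C)
    (fun D => ∑ v ∈ D, (((G.neighborFinset v ∩ I2).card : ℤ) - (G.neighborFinset v ∩ I1).card))
    ⟨_, hmem⟩
  obtain ⟨hsub, hcard⟩ := Finset.mem_powersetCard.1 hC1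
  refine ⟨C1, hsub, hcard, ?_, ?_⟩
  · intro u hu w hw
    rw [Finset.mem_sdiff] at hw
    have hw' : w ∉ C1.erase u := fun h => hw.2 (Finset.mem_of_mem_erase h)
    have hs := hmax (insert w (C1.erase u)) (by
      rw [Finset.mem_powersetCard]
      refine ⟨Finset.insert_subset hw.1 ((Finset.erase_subset _ _).trans hsub), ?_⟩
      rw [Finset.card_insert_of_notMem hw', Finset.card_erase_add_one hu, hcard])
    rw [Finset.sum_insert hw', ← Finset.add_sum_erase C1 _ hu] at hs
    linarith
  · have hs := hmax _ hmem
    have e1 : V1' = (V1' ∩ C) ∪ I1 := by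
      subst hI1 hI; ext a; simp; tauto
    have e2 : V2' = (C \ (V1' ∩ C)) ∪ I2 := by
      subst hI2 hI; ext a
      have ha : a ∈ V1' ∪ V2' := hcut ▸ Finset.mem_univ a
      have hb : a ∈ V1' → a ∉ V2' := fun h => Finset.disjoint_left.1 hdisj h
      simp at ha ⊢; tauto
    have f1 := cutSize_formula G C hC I1 I2 h1 h2 C1 hsub
    have f2 := cutSize_formula G C hC I1 I2 h1 h2 (V1' ∩ C) Finset.inter_subset_right
    rw [← e1, ← e2, ← hm] at f2
    rw [hcard] at f1
    zify
    linarith
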